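/- Let d_v and d_c be real numbers with d_v ≥ 2 and d_c ≥ 2, and let E, D, Z : ℕ → ℝ be nonnegative sequences satisfying E(0) = D(0) = 0, Z(0) ≤ d_v, and for every i ≥ 1: E(i) ≤ (d_v − 2)·E(i−1) + (d_v − 1)·D(i−1), D(i) ≤ (d_v − 1)·Z(i−1) + (d_v − 1)·D(i−1) + (d_v − 2)·E(i−1), and Z(i) ≤ d_v·(d_c − 1)·E(i) + (d_v − 1)·(d_c − 1)·D(i). Then for every ℓ ≥ 0, E(ℓ) + D(ℓ) + Z(ℓ) ≤ d_v·(d_v²·d_c + 2·d_v)^{ℓ+2}. -/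

import Mathlib

/-- **Bounded-difference recursion for the SBB algorithm (Appendix D).**
If `E`, `D`, `Z` are nonnegative sequences with `E 0 = D 0 = 0`, `Z 0 ≤ d_v`, satisfying
the coupled recursive inequalities
`E i ≤ (d_v − 2) E (i−1) + (d_v − 1) D (i−1)`,
`D i ≤ (d_v − 1) Z (i−1) + (d_v − 1) D (i−1) + (d_v − 2) E (i−1)`, and
`Z i ≤ d_v (d_c − 1) E i + (d_v − 1)(d_c − 1) D i` for all `i ≥ 1`, then
`E ℓ + D ℓ + Z ℓ ≤ d_v (d_v² d_c + 2 d_v)^{ℓ+2}` for every `ℓ ≥ 0`. -/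
theorem sbb_bounded_difference_recursion
    (dv dc : ℝ) (hdv : 2 ≤ dv) (hdc : 2 ≤ dc)
    (E D Z : ℕ → ℝ)
    (hEnn : ∀ i, 0 ≤ E i) (hDnn : ∀ i, 0 ≤ D i) (hZnn : ∀ i, 0 ≤ Z i)
    (hE0 : E 0 = 0) (hD0 : D 0 = 0) (hZ0 : Z 0 ≤ dv)
    (hE : ∀ i, 1 ≤ i → E i ≤ (dv - 2) * E (i - 1) + (dv - 1) * D (i - 1))
    (hD : ∀ i, 1 ≤ i →
      D i ≤ (dv - 1) * Z (i - 1) + (dv - 1) * D (i - 1) + (dv - 2) * E (i - 1))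
    (hZ : ∀ i, 1 ≤ i → Z i ≤ dv * (dc - 1) * E i + (dv - 1) * (dc - 1) * D i) :
    ∀ ℓ : ℕ, E ℓ + D ℓ + Z ℓ ≤ dv * (dv ^ 2 * dc + 2 * dv) ^ (ℓ + 2) := by
  have hc : 0 ≤ dc := by linarith
  have hM : 4 ≤ dv * dc := by nlinarith
  have hK : 0 ≤ dv ^ 2 * dc + 2 * dv := by positivity
  obtain ⟨t, ht, htM⟩ : ∃ t : ℝ, 0 ≤ t ∧ (dv * dc) ^ 2 * t = dv :=
    ⟨dv / (dv * dc) ^ 2, by positivity, by field_simp⟩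
  have key : ∀ i, E i ≤ t * (dv ^ 2 * dc + 2 * dv) ^ i ∧
      D i ≤ dv * dc * (t * (dv ^ 2 * dc + 2 * dv) ^ i) ∧
      Z i ≤ (dv * dc) ^ 2 * (t * (dv ^ 2 * dc + 2 * dv) ^ i) := by
    intro i
    induction i with
    | zero =>
      simp only [pow_zero, mul_one, hE0, hD0, htM]
      exact ⟨ht, by positivity, hZ0⟩
    | succ i ih =>
      obtain ⟨ihE, ihD, ihZ⟩ := ih
      have hE' := hE (i + 1) (by omega)
      have hD' := hD (i + 1) (by omega)
      have hZ' := hZ (i + 1) (by omega)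
      simp only [Nat.add_sub_cancel] at hE' hD'
      have hP : 0 ≤ t * (dv ^ 2 * dc + 2 * dv) ^ i := by positivity
      have hQ : t * (dv ^ 2 * dc + 2 * dv) ^ (i + 1) =
          (dv ^ 2 * dc + 2 * dv) * (t * (dv ^ 2 * dc + 2 * dv) ^ i) := by ring
      have hQ0 : 0 ≤ t * (dv ^ 2 * dc + 2 * dv) ^ (i + 1) := by positivity
      have h1 : 0 ≤ dv - 1 := by linarith
      have h2 : 0 ≤ dv - 2 := by linarith
      have h3 : 0 ≤ dc - 1 := by linarith
      have hEs : E (i + 1) ≤ t * (dv ^ 2 * dc + 2 * dv) ^ (i + 1) := by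
        rw [hQ]
        generalize t * (dv ^ 2 * dc + 2 * dv) ^ i = P at *
        calc E (i + 1) ≤ (dv - 2) * P + (dv - 1) * (dv * dc * P) := hE'.trans (by gcongr)
          _ = ((dv - 2) + (dv - 1) * (dv * dc)) * P := by ring
          _ ≤ _ := mul_le_mul_of_nonneg_right (by nlinarith) hP
      have hDs : D (i + 1) ≤ dv * dc * (t * (dv ^ 2 * dc + 2 * dv) ^ (i + 1)) := by
        rw [hQ]
        generalize t * (dv ^ 2 * dc + 2 * dv) ^ i = P at *
        calc D (i + 1) ≤ (dv - 1) * ((dv * dc) ^ 2 * P) + (dv - 1) * (dv * dc * P)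
              + (dv - 2) * P := hD'.trans (by gcongr)
          _ = ((dv - 1) * (dv * dc) ^ 2 + (dv - 1) * (dv * dc) + (dv - 2)) * P := by ring
          _ ≤ (dv * dc * (dv ^ 2 * dc + 2 * dv)) * P := by gcongr; nlinarith
          _ = _ := by ring
      refine ⟨hEs, hDs, ?_⟩
      generalize t * (dv ^ 2 * dc + 2 * dv) ^ (i + 1) = Q at *
      calc Z (i + 1) ≤ dv * (dc - 1) * Q + (dv - 1) * (dc - 1) * (dv * dc * Q) :=
            hZ'.trans (by gcongr)
        _ = (dv * (dc - 1) + (dv - 1) * (dc - 1) * (dv * dc)) * Q := by ring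
        _ ≤ (dv * dc) ^ 2 * Q := by
          gcongr
          nlinarith [mul_nonneg h1 h3, mul_nonneg (by linarith : 0 ≤ dv + dc - 2)
            (by linarith : 0 ≤ dv * dc)]
  intro ℓ
  obtain ⟨hEl, hDl, hZl⟩ := key ℓ
  have hP : 0 ≤ t * (dv ^ 2 * dc + 2 * dv) ^ ℓ := by positivity
  have hKl : 12 ≤ dv ^ 2 * dc + 2 * dv := by nlinarith
  have hR : dv * (dv ^ 2 * dc + 2 * dv) ^ (ℓ + 2) = (dv ^ 2 * dc + 2 * dv) ^ 2 *
      ((dv * dc) ^ 2 * (t * (dv ^ 2 * dc + 2 * dv) ^ ℓ)) := by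
    rw [← mul_assoc ((dv * dc) ^ 2), htM]
    ring
  rw [hR]
  generalize t * (dv ^ 2 * dc + 2 * dv) ^ ℓ = P at *
  calc E ℓ + D ℓ + Z ℓ ≤ (1 + dv * dc + (dv * dc) ^ 2) * P := by linarith
    _ ≤ (3 * (dv * dc) ^ 2) * P := by gcongr; nlinarith
    _ = 3 * ((dv * dc) ^ 2 * P) := by ring
    _ ≤ _ := by gcongr; nlinarith
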